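/- For λ ∈ (0,1), the modularity of the optimal two-community partition of the λ-graphon (split at x₁ = 1/2) equals Q_max(λ) = (L(0,1/2) + L(1/2,1))/μ = λ(1−λ)/(2(3λ+1)²), where L(a,b) = ∫ₐᵇ∫ₐᵇ B(x,y) dx dy, B is the modularity surface, and μ is the edge density of the λ-graphon. -/

import Mathlib

open MeasureTheory

/-- The integral of an affine function over an interval. -/
lemma integral_affine (p q a b : ℝ) :
    ∫ y in a..b, (p * y + q) = p * ((b ^ 2 - a ^ 2) / 2) + q * (b - a) := by
  rw [intervalIntegral.integral_add (Continuous.intervalIntegrable (by fun_prop) _ _)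
    (Continuous.intervalIntegrable (by fun_prop) _ _),
    intervalIntegral.integral_const_mul, integral_id, intervalIntegral.integral_const, smul_eq_mul]
  ring

/-- The integral of a symmetric biaffine function over a square. -/
lemma integral_integral_biaffine (p q r a b : ℝ) :
    ∫ x in a..b, ∫ y in a..b, (p * x * y + q * (x + y) + r) =
      p * ((b ^ 2 - a ^ 2) / 2) ^ 2 + q * (b ^ 2 - a ^ 2) * (b - a) + r * (b - a) ^ 2 := by
  have inner_integral (x : ℝ) : ∫ y in a..b, (p * x * y + q * (x + y) + r) =
      (p * ((b ^ 2 - a ^ 2) / 2) + q * (b - a)) * x +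
        (q * ((b ^ 2 - a ^ 2) / 2) + r * (b - a)) := by
    rw [show (fun y : ℝ => p * x * y + q * (x + y) + r) =
      fun y => (p * x + q) * y + (q * x + r) by funext y; ring, integral_affine]
    ring
  simp_rw [inner_integral, integral_affine]
  ring

/-- For `λ ∈ (0,1)`, the modularity of the optimal two-community partition
(split at `x₁ = 1/2`) of the λ-graphon equals
`Q_max(λ) = (L(0,1/2)+L(1/2,1))/μ = λ(1−λ)/(2(3λ+1)²)`. -/
theorem lambda_graphon_maximum_modularity_value
    (lam : ℝ) (hlam : lam ∈ Set.Ioo (0:ℝ) 1)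
    (W : ℝ → ℝ → ℝ) (hW : ∀ x y, W x y = (1 - lam) * x * y + lam)
    (k : ℝ → ℝ) (hk : ∀ x, k x = ∫ y in (0:ℝ)..1, W x y)
    (μ : ℝ) (hμ : μ = ∫ x in (0:ℝ)..1, ∫ y in (0:ℝ)..1, W x y)
    (B : ℝ → ℝ → ℝ) (hB : ∀ x y, B x y = W x y - k x * k y / μ)
    (L : ℝ → ℝ → ℝ) (hL : ∀ a b, L a b = ∫ x in a..b, ∫ y in a..b, B x y) :
    (L 0 (1/2) + L (1/2) 1) / μ = lam * (1 - lam) / (2 * (3 * lam + 1) ^ 2) := by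
  obtain ⟨hlam_pos, -⟩ := hlam
  have degree_eq (x : ℝ) : k x = (1 - lam) / 2 * x + lam := by
    simp_rw [hk, hW, integral_affine]
    ring
  have density_eq : μ = (3 * lam + 1) / 4 := by
    simp_rw [hμ, ← hk, degree_eq, integral_affine]
    ring
  have surface_eq (x y : ℝ) : B x y =
      ((1 - lam) - (1 - lam) ^ 2 / (4 * μ)) * x * y +
        (-((1 - lam) * lam / (2 * μ))) * (x + y) + (lam - lam ^ 2 / μ) := by
    have hμ_ne : μ ≠ 0 := by rw [density_eq]; positivity
    rw [hB, hW, degree_eq, degree_eq]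
    field_simp
    ring
  simp_rw [hL, surface_eq, integral_integral_biaffine, density_eq]
  have hden : 3 * lam + 1 ≠ 0 := by positivity
  field_simp
  ring
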